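/- arXiv:1802.09749 — 7 statements merged into one kernel-verified Lean document; each statement's English description precedes it below -/
import Mathlib

section
/- For every integer k ≥ 0 and all real numbers p and q, A_{2k+1}(p,q) = A_{2k+1}(q,p); that is, the joint distribution of the pair (odes, edes) over the symmetric group S_{2k+1} is symmetric: for all integers i, j, the number of permutations π of [2k+1] with odes(π) = i and edes(π) = j equals the number with odes(π) = j and edes(π) = i. -/
/-- `i` (a 1-based index) is a descent of the permutation `π` of `{0,…,n-1}`
(in one-line notation, using 0-based values), i.e. `1 ≤ i ≤ n-1` and `π_i > π_{i+1}`
in the 1-based convention of the paper. -/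
def IsDesc {n : ℕ} (π : Equiv.Perm (Fin n)) (i : ℕ) : Prop :=
  ∃ h : i < n, 0 < i ∧ π ⟨i, h⟩ < π ⟨i - 1, lt_of_le_of_lt (Nat.sub_le i 1) h⟩

instance {n : ℕ} (π : Equiv.Perm (Fin n)) (i : ℕ) : Decidable (IsDesc π i) := by
  unfold IsDesc; infer_instance

/-- the number of odd descents of `π` -/
def odes (n : ℕ) (π : Equiv.Perm (Fin n)) : ℕ :=
  ((Finset.range n).filter fun i => Odd i ∧ IsDesc π i).card

/-- the number of even descents of `π` -/
def edes (n : ℕ) (π : Equiv.Perm (Fin n)) : ℕ :=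
  ((Finset.range n).filter fun i => Even i ∧ IsDesc π i).card

/-- the refined Eulerian polynomial `A_n(p,q)` -/
noncomputable def A (n : ℕ) (p q : ℝ) : ℝ :=
  ∑ π : Equiv.Perm (Fin n), p ^ odes n π * q ^ edes n π

/-- the reverse-complement of a permutation -/
def rcPerm (n : ℕ) (π : Equiv.Perm (Fin n)) : Equiv.Perm (Fin n) :=
  Fin.revPerm * π * Fin.revPerm

theorem rcPerm_rcPerm (n : ℕ) (π : Equiv.Perm (Fin n)) : rcPerm n (rcPerm n π) = π := by
  ext x
  simp [rcPerm]

theorem isDesc_rcPerm {n : ℕ} (π : Equiv.Perm (Fin n)) (i : ℕ) (h : IsDesc π i) :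
    IsDesc (rcPerm n π) (n - i) := by
  obtain ⟨h1, h2, h3⟩ := h
  refine ⟨by omega, by omega, ?_⟩
  have e1 : Fin.rev (⟨n - i, by omega⟩ : Fin n) = ⟨i - 1, by omega⟩ := by
    ext; simp [Fin.rev]; omega
  have e2 : Fin.rev (⟨n - i - 1, by omega⟩ : Fin n) = ⟨i, h1⟩ := by
    ext; simp [Fin.rev]; omega
  simp only [rcPerm, Equiv.Perm.mul_apply, Fin.revPerm_apply, e1, e2, Fin.rev_lt_rev]
  exact h3

theorem isDesc_rcPerm' {n : ℕ} (π : Equiv.Perm (Fin n)) (i : ℕ) (h : IsDesc (rcPerm n π) i) :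
    IsDesc π (n - i) := by
  have := isDesc_rcPerm _ _ h
  rwa [rcPerm_rcPerm] at this

theorem odes_rcPerm (k : ℕ) (π : Equiv.Perm (Fin (2 * k + 1))) :
    odes (2 * k + 1) (rcPerm _ π) = edes (2 * k + 1) π := by
  unfold odes edes
  refine Finset.card_bij' (fun i _ => 2 * k + 1 - i) (fun i _ => 2 * k + 1 - i) ?_ ?_ ?_ ?_
  · intro i hi
    simp only [Finset.mem_filter, Finset.mem_range] at hi ⊢
    obtain ⟨h1, h2, h3⟩ := hi
    have := h3.2.1
    refine ⟨by omega, ?_, isDesc_rcPerm' _ _ h3⟩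
    rw [Nat.odd_iff] at h2
    rw [Nat.even_iff]
    omega
  · intro i hi
    simp only [Finset.mem_filter, Finset.mem_range] at hi ⊢
    obtain ⟨h1, h2, h3⟩ := hi
    have := h3.2.1
    refine ⟨by omega, ?_, isDesc_rcPerm _ _ h3⟩
    rw [Nat.even_iff] at h2
    rw [Nat.odd_iff]
    omega
  · intro i hi
    simp only [Finset.mem_filter, Finset.mem_range] at hi
    omega
  · intro i hi
    simp only [Finset.mem_filter, Finset.mem_range] at hi
    omega

theorem edes_rcPerm (k : ℕ) (π : Equiv.Perm (Fin (2 * k + 1))) :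
    edes (2 * k + 1) (rcPerm _ π) = odes (2 * k + 1) π := by
  rw [← odes_rcPerm, rcPerm_rcPerm]

theorem stmt0 (k : ℕ) (p q : ℝ) (i j : ℕ) :
    A (2 * k + 1) p q = A (2 * k + 1) q p ∧
    (Finset.univ.filter fun π : Equiv.Perm (Fin (2 * k + 1)) =>
        odes (2 * k + 1) π = i ∧ edes (2 * k + 1) π = j).card =
      (Finset.univ.filter fun π : Equiv.Perm (Fin (2 * k + 1)) =>
        odes (2 * k + 1) π = j ∧ edes (2 * k + 1) π = i).card := by
  constructor
  · unfold A
    refine Finset.sum_bij' (fun π _ => rcPerm _ π) (fun π _ => rcPerm _ π) ?_ ?_ ?_ ?_ ?_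
    · simp
    · simp
    · intro π _; exact rcPerm_rcPerm _ π
    · intro π _; exact rcPerm_rcPerm _ π
    · intro π _
      rw [odes_rcPerm, edes_rcPerm, mul_comm]
  · refine Finset.card_bij' (fun π _ => rcPerm _ π) (fun π _ => rcPerm _ π) ?_ ?_ ?_ ?_
    · intro π h
      simp only [Finset.mem_filter, Finset.mem_univ, true_and] at h ⊢
      rw [odes_rcPerm, edes_rcPerm]; exact h.symm
    · intro π h
      simp only [Finset.mem_filter, Finset.mem_univ, true_and] at h ⊢
      rw [odes_rcPerm, edes_rcPerm]; exact h.symm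
    · intro π _; exact rcPerm_rcPerm _ π
    · intro π _; exact rcPerm_rcPerm _ π
end

section
/- For every integer k ≥ 0 and all integers i, j, the number of permutations π of [2k+1] with odes(π) = i and edes(π) = j equals the number of permutations π of [2k+1] with odes(π) = k − i and edes(π) = k − j; equivalently, A_{2k+1}(p,q) = (pq)^k A_{2k+1}(1/p, 1/q) for all nonzero real p, q. -/
/-- the complement of a permutation -/
def complPerm {n : ℕ} (π : Equiv.Perm (Fin n)) : Equiv.Perm (Fin n) := π.trans Fin.revPerm

theorem complPerm_complPerm {n : ℕ} (π : Equiv.Perm (Fin n)) : complPerm (complPerm π) = π := by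
  ext x; simp [complPerm]

theorem isDesc_complPerm {n : ℕ} (π : Equiv.Perm (Fin n)) (i : ℕ) (h : i < n) (h0 : 0 < i) :
    IsDesc (complPerm π) i ↔ ¬ IsDesc π i := by
  have hne : π ⟨i, h⟩ ≠ π ⟨i - 1, lt_of_le_of_lt (Nat.sub_le i 1) h⟩ := by
    intro e
    have := π.injective e
    simp only [Fin.mk.injEq] at this
    omega
  constructor
  · rintro ⟨_, _, h1⟩ ⟨_, _, h2⟩
    simp only [complPerm, Equiv.trans_apply, Fin.revPerm_apply, Fin.rev_lt_rev] at h1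
    exact lt_asymm h1 h2
  · intro hn
    refine ⟨h, h0, ?_⟩
    simp only [complPerm, Equiv.trans_apply, Fin.revPerm_apply, Fin.rev_lt_rev]
    refine lt_of_le_of_ne (not_lt.1 fun hl => hn ⟨h, h0, hl⟩) hne.symm

theorem card_desc_add {n : ℕ} (π : Equiv.Perm (Fin n)) (P : ℕ → Prop) [DecidablePred P] :
    ((Finset.range n).filter fun i => P i ∧ IsDesc π i).card +
      ((Finset.range n).filter fun i => P i ∧ IsDesc (complPerm π) i).card =
      ((Finset.range n).filter fun i => P i ∧ 0 < i).card := by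
  rw [← Finset.card_union_of_disjoint]
  · congr 1
    ext i
    simp only [Finset.mem_union, Finset.mem_filter, Finset.mem_range]
    constructor
    · rintro (⟨h, hP, h1, h2, _⟩ | ⟨h, hP, h1, h2, _⟩) <;> exact ⟨h, hP, h2⟩
    · rintro ⟨h, hP, h0⟩
      have := isDesc_complPerm π i h h0
      tauto
  · rw [Finset.disjoint_left]
    intro i h1 h2
    simp only [Finset.mem_filter, Finset.mem_range] at h1 h2
    have h0 : 0 < i := h1.2.2.2.1
    exact (isDesc_complPerm π i h1.1 h0).1 h2.2.2 h1.2.2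

theorem card_odd_range (k : ℕ) :
    ((Finset.range (2 * k + 1)).filter fun i => Odd i ∧ 0 < i).card = k := by
  induction k with
  | zero => decide
  | succ k ih =>
    rw [show 2 * (k + 1) + 1 = (2 * k + 1) + 1 + 1 by ring, Finset.range_add_one,
      Finset.range_add_one, Finset.filter_insert, Finset.filter_insert, if_neg, if_pos,
      Finset.card_insert_of_notMem, ih]
    · simp
    · exact ⟨⟨k, rfl⟩, by omega⟩
    · rintro ⟨⟨m, hm⟩, _⟩; omega

theorem card_even_range (k : ℕ) :
    ((Finset.range (2 * k + 1)).filter fun i => Even i ∧ 0 < i).card = k := by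
  induction k with
  | zero => decide
  | succ k ih =>
    rw [show 2 * (k + 1) + 1 = (2 * k + 1) + 1 + 1 by ring, Finset.range_add_one,
      Finset.range_add_one, Finset.filter_insert, Finset.filter_insert, if_pos, if_neg,
      Finset.card_insert_of_notMem, ih]
    · simp
    · rintro ⟨⟨m, hm⟩, _⟩; omega
    · exact ⟨⟨k + 1, by ring⟩, by omega⟩

theorem odes_add (k : ℕ) (π : Equiv.Perm (Fin (2 * k + 1))) :
    odes (2 * k + 1) π + odes (2 * k + 1) (complPerm π) = k :=
  (card_desc_add π Odd).trans (card_odd_range k)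

theorem edes_add (k : ℕ) (π : Equiv.Perm (Fin (2 * k + 1))) :
    edes (2 * k + 1) π + edes (2 * k + 1) (complPerm π) = k :=
  (card_desc_add π Even).trans (card_even_range k)

theorem stmt1 (k : ℕ) (i j : ℤ) (p q : ℝ) (hp : p ≠ 0) (hq : q ≠ 0) :
    (Finset.univ.filter fun π : Equiv.Perm (Fin (2 * k + 1)) =>
        (odes (2 * k + 1) π : ℤ) = i ∧ (edes (2 * k + 1) π : ℤ) = j).card =
      (Finset.univ.filter fun π : Equiv.Perm (Fin (2 * k + 1)) =>
        (odes (2 * k + 1) π : ℤ) = (k : ℤ) - i ∧ (edes (2 * k + 1) π : ℤ) = (k : ℤ) - j).card ∧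
    A (2 * k + 1) p q = (p * q) ^ k * A (2 * k + 1) (1 / p) (1 / q) := by
  constructor
  · refine Finset.card_bij' (fun π _ => complPerm π) (fun π _ => complPerm π) ?_ ?_
      (fun π _ => complPerm_complPerm π) (fun π _ => complPerm_complPerm π)
    all_goals
      intro π hπ
      simp only [Finset.mem_filter, Finset.mem_univ, true_and] at hπ ⊢
      have h1 := odes_add k π
      have h2 := edes_add k π
      omega
  · unfold A
    rw [Finset.mul_sum]
    refine Finset.sum_bij' (fun π _ => complPerm π) (fun π _ => complPerm π) (by simp) (by simp)
      (fun π _ => complPerm_complPerm π) (fun π _ => complPerm_complPerm π) ?_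
    intro π _
    have h1 := odes_add k π
    have h2 := edes_add k π
    have e1 : p ^ k = p ^ odes (2 * k + 1) π * p ^ odes (2 * k + 1) (complPerm π) := by
      rw [← pow_add, h1]
    have e2 : q ^ k = q ^ edes (2 * k + 1) π * q ^ edes (2 * k + 1) (complPerm π) := by
      rw [← pow_add, h2]
    rw [mul_pow, e1, e2, one_div, one_div, inv_pow, inv_pow]
    have := pow_ne_zero (odes (2 * k + 1) (complPerm π)) hp
    have := pow_ne_zero (edes (2 * k + 1) (complPerm π)) hq
    field_simp
end

section
/- For every integer k ≥ 1 and all real numbers p and q, (1 + q)·A_{2k}(p,q) = (1 + p)·A_{2k}(q,p). -/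
open Finset

/-- value at position `i`, as a natural number -/
def vl {n : ℕ} (π : Equiv.Perm (Fin n)) (i : ℕ) : ℕ := if h : i < n then (π ⟨i, h⟩ : ℕ) else 0

lemma isDesc_iff {n : ℕ} (π : Equiv.Perm (Fin n)) (i : ℕ) :
    IsDesc π i ↔ i < n ∧ 0 < i ∧ vl π i < vl π (i - 1) := by
  unfold IsDesc vl
  constructor
  · rintro ⟨h, h0, h1⟩
    have h2 : i - 1 < n := by omega
    refine ⟨h, h0, ?_⟩
    rw [dif_pos h, dif_pos h2]
    exact h1
  · rintro ⟨h, h0, h1⟩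
    have h2 : i - 1 < n := by omega
    rw [dif_pos h, dif_pos h2] at h1
    exact ⟨h, h0, h1⟩

lemma vl_inj {n : ℕ} (π : Equiv.Perm (Fin n)) {i j : ℕ} (hi : i < n) (hj : j < n)
    (h : vl π i = vl π j) : i = j := by
  unfold vl at h
  rw [dif_pos hi, dif_pos hj] at h
  have := π.injective (Fin.ext h)
  simpa using this

/-- sign of the edge `i` -/
noncomputable def sg {n : ℕ} (π : Equiv.Perm (Fin n)) (i : ℕ) : ℝ :=
  if i = 0 then 0 else if IsDesc π i then -1 else 1

/-- reversal of positions `c, …, m-1` -/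
def rv (c m i : ℕ) : ℕ := if c ≤ i ∧ i < m then c + m - 1 - i else i

/-- reversal as a permutation -/
def rvP (n c m : ℕ) (hm : m ≤ n) : Equiv.Perm (Fin n) :=
  Function.Involutive.toPerm
    (fun i => ⟨rv c m i, by have := i.2; unfold rv; split_ifs <;> omega⟩)
    (by
      intro i
      apply Fin.ext
      simp only [rv]
      split_ifs <;> omega)

lemma vl_rv {n c m : ℕ} (hm : m ≤ n) (π : Equiv.Perm (Fin n)) {i : ℕ} (hi : i < n) :
    vl (π * rvP n c m hm) i = vl π (rv c m i) := by
  have h : rv c m i < n := by unfold rv; split_ifs <;> omega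
  unfold vl
  rw [dif_pos hi, dif_pos h]
  rfl

lemma sg_rv {n c m : ℕ} (hm : m ≤ n) (π : Equiv.Perm (Fin n)) {i : ℕ} (hi : i < n)
    (hc : i ≠ c) (him : i ≠ m) :
    sg (π * rvP n c m hm) i = (if c < i ∧ i < m then -1 else 1) *
      sg π (if c < i ∧ i < m then c + m - i else i) := by
  by_cases h0 : i = 0
  · subst h0; simp [sg]
  have hi1 : i - 1 < n := by omega
  by_cases h : c < i ∧ i < m
  · rw [if_pos h, if_pos h]
    have e1 : rv c m i = c + m - i - 1 := by unfold rv; split_ifs <;> omega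
    have e2 : rv c m (i - 1) = c + m - i := by unfold rv; split_ifs <;> omega
    have hne : vl π (c + m - i) ≠ vl π (c + m - i - 1) := by
      intro hh
      have := vl_inj π (by omega) (by omega) hh
      omega
    have h0' : c + m - i ≠ 0 := by omega
    simp only [sg, if_neg h0, if_neg h0', isDesc_iff, vl_rv hm π hi, vl_rv hm π hi1, e1, e2]
    split_ifs <;> first | (exfalso; omega) | norm_num
  · rw [if_neg h, if_neg h]
    have e1 : rv c m i = i := by unfold rv; split_ifs <;> omega
    have e2 : rv c m (i - 1) = i - 1 := by unfold rv; split_ifs <;> omega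
    simp only [sg, isDesc_iff, vl_rv hm π hi, vl_rv hm π hi1, e1, e2, one_mul]

lemma sum_zero {n c m : ℕ} (hm : m ≤ n) (S : Finset ℕ) (hS : S ⊆ range n)
    (hc : c ∉ S) (hmS : m ∉ S) (hin : ∀ i, c < i → i < m → i ∈ S) (hodd : Odd (m - c - 1)) :
    ∑ π : Equiv.Perm (Fin n), ∏ i ∈ S, sg π i = 0 := by
  have key : ∀ π : Equiv.Perm (Fin n),
      ∏ i ∈ S, sg (π * rvP n c m hm) i = - ∏ i ∈ S, sg π i := by
    intro π
    have h1 : ∏ i ∈ S, sg (π * rvP n c m hm) i =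
        ∏ i ∈ S, ((if c < i ∧ i < m then (-1 : ℝ) else 1) *
          sg π (if c < i ∧ i < m then c + m - i else i)) := by
      apply prod_congr rfl
      intro i hi
      exact sg_rv hm π (mem_range.1 (hS hi)) (fun h => hc (h ▸ hi)) (fun h => hmS (h ▸ hi))
    rw [h1, prod_mul_distrib]
    have h2 : ∏ i ∈ S, (if c < i ∧ i < m then (-1 : ℝ) else 1) = -1 := by
      rw [← prod_filter, prod_const]
      have : S.filter (fun i => c < i ∧ i < m) = Ioo c m := by
        ext i
        simp only [mem_filter, mem_Ioo]
        exact ⟨fun h => h.2, fun h => ⟨hin i h.1 h.2, h⟩⟩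
      rw [this, Nat.card_Ioo]
      exact hodd.neg_one_pow
    have h3 : ∏ i ∈ S, sg π (if c < i ∧ i < m then c + m - i else i) = ∏ i ∈ S, sg π i := by
      have hmem : ∀ i ∈ S, (if c < i ∧ i < m then c + m - i else i) ∈ S := by
        intro i hi
        split_ifs with h
        · exact hin _ (by omega) (by omega)
        · exact hi
      have hinv : ∀ i ∈ S, (fun i => if c < i ∧ i < m then c + m - i else i)
          ((fun i => if c < i ∧ i < m then c + m - i else i) i) = i := by
        intro i hi
        dsimp only
        split_ifs <;> omega
      exact prod_nbij' (fun i => if c < i ∧ i < m then c + m - i else i)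
        (fun i => if c < i ∧ i < m then c + m - i else i) hmem hmem hinv hinv (fun _ _ => rfl)
    rw [h2, h3]; ring
  have h := Equiv.sum_comp (Equiv.mulRight (rvP n c m hm))
    (fun π : Equiv.Perm (Fin n) => ∏ i ∈ S, sg π i)
  simp only [Equiv.coe_mulRight, key, sum_neg_distrib] at h
  linarith

lemma alt_sum (c d : ℕ) (h : Even d) : ∑ i ∈ Ico c (c + d), (-1 : ℤ) ^ i = 0 := by
  obtain ⟨e, rfl⟩ := h
  induction e with
  | zero => simp
  | succ e ih =>
    have : c + (e + 1 + (e + 1)) = c + (e + e) + 1 + 1 := by ring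
    rw [this, sum_Ico_succ_top (by omega), sum_Ico_succ_top (by omega), ih]
    ring

lemma bal (S : Finset ℕ) (n : ℕ) (h0 : 0 ∉ S)
    (H : ∀ c m, c < m → m ≤ n → c ∉ S → m ∉ S → (∀ i, c < i → i < m → i ∈ S) → Even (m - c - 1)) :
    ∀ m, m ≤ n → m ∉ S → ∑ i ∈ range m, (if i ∈ S then (-1 : ℤ) ^ i else 0) = 0 := by
  intro m
  induction m using Nat.strong_induction_on with
  | _ m ih =>
    intro hm hmS
    rcases Nat.eq_zero_or_pos m with rfl | hpos
    · simp
    have hne : ((range m).filter (fun i => i ∉ S)).Nonempty :=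
      ⟨0, by simp [hpos, h0]⟩
    obtain ⟨c, hc, hmax⟩ := exists_max_image _ (fun i => i) hne
    simp only [mem_filter, mem_range] at hc hmax
    have hin : ∀ i, c < i → i < m → i ∈ S := by
      intro i h1 h2
      by_contra h3
      have := hmax i ⟨h2, h3⟩
      omega
    have hev := H c m hc.1 hm hc.2 hmS hin
    have hI := ih c hc.1 (by omega) hc.2
    rw [range_eq_Ico] at hI ⊢
    rw [← sum_Ico_consecutive _ (Nat.zero_le (c + 1)) (by omega : c + 1 ≤ m),
      sum_Ico_succ_top (Nat.zero_le c), hI, if_neg hc.2]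
    have h4 : ∑ i ∈ Ico (c + 1) m, (if i ∈ S then (-1 : ℤ) ^ i else 0) =
        ∑ i ∈ Ico (c + 1) m, (-1 : ℤ) ^ i := by
      apply sum_congr rfl
      intro i hi
      rw [mem_Ico] at hi
      rw [if_pos (hin i (by omega) hi.2)]
    have h5 := alt_sum (c + 1) (m - c - 1) hev
    rw [show c + 1 + (m - c - 1) = m by omega] at h5
    rw [h4, h5]; simp

lemma sum_pm (S : Finset ℕ) : ∑ i ∈ S, (-1 : ℤ) ^ i =
    ((S.filter (fun i => Even i)).card : ℤ) - (S.filter (fun i => ¬ Even i)).card := by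
  rw [← sum_filter_add_sum_filter_not S (fun i => Even i)]
  rw [sum_congr rfl (g := fun _ => (1 : ℤ)) (fun i hi => (mem_filter.1 hi).2.neg_one_pow)]
  rw [sum_congr rfl (s₁ := S.filter (fun i => ¬ Even i)) (g := fun _ => (-1 : ℤ))
    (fun i hi => (Nat.not_even_iff_odd.1 (mem_filter.1 hi).2).neg_one_pow)]
  simp [sub_eq_add_neg]

lemma prod_sym (S : Finset ℕ) (h : ∑ i ∈ S, (-1 : ℤ) ^ i = 0) (x y : ℝ) :
    ∏ i ∈ S, (if Even i then x else y) = ∏ i ∈ S, (if Even i then y else x) := by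
  rw [sum_pm] at h
  have h' : (S.filter (fun i => Even i)).card = (S.filter (fun i => ¬ Even i)).card := by omega
  simp only [prod_ite, prod_const, h']
  ring

lemma expand (k : ℕ) (hk : 1 ≤ k) (p q : ℝ) :
    (1 + q) / 2 * A (2 * k) p q = ∑ S ∈ (range (2 * k)).powerset,
      (∏ i ∈ S, (if Even i then (1 - q) / 2 else (1 - p) / 2)) *
      (∏ i ∈ range (2 * k) \ S, (if Even i then (1 + q) / 2 else (1 + p) / 2)) *
      ∑ π : Equiv.Perm (Fin (2 * k)), ∏ i ∈ S, sg π i := by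
  have h1 : ∀ π : Equiv.Perm (Fin (2 * k)),
      (1 + q) / 2 * (p ^ odes (2 * k) π * q ^ edes (2 * k) π) =
      ∏ i ∈ range (2 * k), ((if Even i then (1 - q) / 2 else (1 - p) / 2) * sg π i +
        (if Even i then (1 + q) / 2 else (1 + p) / 2)) := by
    intro π
    have e1 : ∀ x : ℝ, ∀ P : ℕ → Prop, ∀ _ : DecidablePred P,
        x ^ ((range (2 * k)).filter P).card = ∏ i ∈ range (2 * k), if P i then x else 1 := by
      intro x P _
      rw [← prod_filter, prod_const]
    unfold odes edes
    rw [e1, e1, ← prod_mul_distrib]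
    obtain ⟨j, hj⟩ : ∃ j, 2 * k = j + 1 := ⟨2 * k - 1, by omega⟩
    have hr : range (2 * k) = insert 0 (Ico 1 (2 * k)) := by
      ext i; simp only [mem_range, mem_insert, mem_Ico]; omega
    rw [hr, prod_insert (by simp), prod_insert (by simp)]
    have z : ¬ IsDesc π 0 := by rw [isDesc_iff]; omega
    simp only [z, sg, and_false, if_false, if_true, mul_zero, zero_add, one_mul, Even.zero]
    congr 1
    apply prod_congr rfl
    intro i hi
    have hi0 : i ≠ 0 := by rw [mem_Ico] at hi; omega
    rw [if_neg hi0]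
    by_cases hE : Even i
    · have hO : ¬ Odd i := Nat.not_odd_iff_even.2 hE
      by_cases hD : IsDesc π i
      · simp only [hE, hO, hD, if_true, if_false, true_and, false_and]; ring
      · simp only [hE, hO, hD, if_true, if_false, and_false, false_and]; ring
    · have hO : Odd i := Nat.not_even_iff_odd.1 hE
      by_cases hD : IsDesc π i
      · simp only [hE, hO, hD, if_true, if_false, true_and, false_and]; ring
      · simp only [hE, hO, hD, if_true, if_false, and_false, false_and]; ring
  unfold A
  rw [mul_sum]
  simp only [h1, prod_add, prod_mul_distrib]
  rw [sum_comm]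
  apply sum_congr rfl
  intro S _
  rw [mul_sum]
  apply sum_congr rfl
  intro π _
  ring

theorem stmt2 (k : ℕ) (hk : 1 ≤ k) (p q : ℝ) :
    (1 + q) * A (2 * k) p q = (1 + p) * A (2 * k) q p := by
  suffices h : (1 + q) / 2 * A (2 * k) p q = (1 + p) / 2 * A (2 * k) q p by linarith
  rw [expand k hk, expand k hk]
  apply sum_congr rfl
  intro S hS
  rw [mem_powerset] at hS
  by_cases hz : ∑ π : Equiv.Perm (Fin (2 * k)), ∏ i ∈ S, sg π i = 0
  · rw [hz]; simp
  have h0 : 0 ∉ S := by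
    intro h0
    apply hz
    apply sum_eq_zero
    intro π _
    exact prod_eq_zero h0 (by simp [sg])
  have hb := bal S (2 * k) h0 (by
    intro c m _ hm hc hmS hin
    by_contra hne
    exact hz (sum_zero hm S hS hc hmS hin (Nat.not_even_iff_odd.1 hne)))
    (2 * k) le_rfl (fun h => by simpa using hS h)
  rw [← sum_filter, filter_mem_eq_inter, inter_eq_right.2 hS] at hb
  have hb2 : ∑ i ∈ range (2 * k) \ S, (-1 : ℤ) ^ i = 0 := by
    have h1 := sum_sdiff (f := fun i => (-1 : ℤ) ^ i) hS
    have h2 := alt_sum 0 (2 * k) (even_two_mul k)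
    rw [zero_add, ← range_eq_Ico] at h2
    linarith
  rw [prod_sym S hb, prod_sym _ hb2]
end

section
/- For every integer k ≥ 1 and all nonzero real numbers p and q, (1 + q)·A_{2k}(p,q) = (pq)^k · (1 + 1/q)·A_{2k}(1/p, 1/q); that is, the polynomial (1+q)A_{2k}(p,q) is invariant under the substitution (p,q) ↦ (1/p,1/q) followed by multiplication by (pq)^k. -/
theorem isDesc_rev {n : ℕ} (π : Equiv.Perm (Fin n)) (i : ℕ) (hi : i < n) (h0 : 0 < i) :
    IsDesc (π.trans Fin.revPerm) i ↔ ¬ IsDesc π i := by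
  have hne : π ⟨i, hi⟩ ≠ π ⟨i - 1, lt_of_le_of_lt (Nat.sub_le i 1) hi⟩ := by
    intro h
    have h2 := congrArg Fin.val (π.injective h)
    simp only at h2
    omega
  unfold IsDesc
  simp only [hi, h0, exists_true_left, true_and, Equiv.trans_apply, Fin.revPerm_apply,
    Fin.rev_lt_rev, not_lt]
  exact ⟨le_of_lt, fun h => lt_of_le_of_ne h (Ne.symm hne)⟩

theorem card_rev {n : ℕ} (π : Equiv.Perm (Fin n)) (P : ℕ → Prop) [DecidablePred P] :
    ((Finset.range n).filter fun i => P i ∧ IsDesc π i).card +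
    ((Finset.range n).filter fun i => P i ∧ IsDesc (π.trans Fin.revPerm) i).card =
    ((Finset.range n).filter fun i => P i ∧ 0 < i).card := by
  have h1 : ((Finset.range n).filter fun i => P i ∧ IsDesc π i) =
      ((Finset.range n).filter fun i => P i ∧ 0 < i).filter fun i => IsDesc π i := by
    ext i
    simp only [Finset.mem_filter, Finset.mem_range]
    constructor
    · rintro ⟨a, b, c⟩
      exact ⟨⟨a, b, c.2.1⟩, c⟩
    · rintro ⟨⟨a, b, _⟩, c⟩
      exact ⟨a, b, c⟩
  have h2 : ((Finset.range n).filter fun i => P i ∧ IsDesc (π.trans Fin.revPerm) i) =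
      ((Finset.range n).filter fun i => P i ∧ 0 < i).filter fun i => ¬ IsDesc π i := by
    ext i
    simp only [Finset.mem_filter, Finset.mem_range]
    constructor
    · rintro ⟨a, b, c⟩
      exact ⟨⟨a, b, c.2.1⟩, (isDesc_rev π i a c.2.1).1 c⟩
    · rintro ⟨⟨a, b, d⟩, c⟩
      exact ⟨a, b, (isDesc_rev π i a d).2 c⟩
  rw [h1, h2, Finset.card_filter_add_card_filter_not]

theorem card_odd (k : ℕ) :
    ((Finset.range (2 * k)).filter fun i => Odd i ∧ 0 < i).card = k := by
  induction k with
  | zero => simp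
  | succ k ih =>
    rw [show 2 * (k + 1) = 2 * k + 1 + 1 by ring, Finset.range_add_one, Finset.range_add_one,
      Finset.filter_insert, Finset.filter_insert, if_pos (by constructor <;> simp),
      if_neg (by simp), Finset.card_insert_of_notMem (by simp), ih]

theorem card_even (k : ℕ) :
    ((Finset.range (2 * (k + 1))).filter fun i => Even i ∧ 0 < i).card = k := by
  induction k with
  | zero => decide
  | succ k ih =>
    rw [show 2 * (k + 1 + 1) = 2 * (k + 1) + 1 + 1 by ring, Finset.range_add_one,
      Finset.range_add_one, Finset.filter_insert, Finset.filter_insert,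
      if_neg (by simp), if_pos (by constructor <;> simp),
      Finset.card_insert_of_notMem (by simp), ih]

theorem stmt3 (k : ℕ) (hk : 1 ≤ k) (p q : ℝ) (hp : p ≠ 0) (hq : q ≠ 0) :
    (1 + q) * A (2 * k) p q = (p * q) ^ k * ((1 + 1 / q) * A (2 * k) (1 / p) (1 / q)) := by
  obtain ⟨m, rfl⟩ : ∃ m, k = m + 1 := ⟨k - 1, by omega⟩
  have key : A (2 * (m + 1)) p q =
      p ^ (m + 1) * q ^ m * A (2 * (m + 1)) (1 / p) (1 / q) := by
    unfold A
    rw [Finset.mul_sum]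
    refine Fintype.sum_equiv (Equiv.mulLeft Fin.revPerm) _ _ fun π => ?_
    have ho : odes _ π + odes _ (π.trans Fin.revPerm) = m + 1 :=
      (card_rev π Odd).trans (card_odd (m + 1))
    have he : edes _ π + edes _ (π.trans Fin.revPerm) = m :=
      (card_rev π Even).trans (card_even m)
    change _ = p ^ (m + 1) * q ^ m * ((1 / p) ^ odes _ (π.trans Fin.revPerm) *
      (1 / q) ^ edes _ (π.trans Fin.revPerm))
    generalize odes _ (π.trans Fin.revPerm) = a at *
    generalize edes _ (π.trans Fin.revPerm) = b at *
    generalize odes _ π = c at *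
    generalize edes _ π = d at *
    have ep : p ^ (m + 1) = p ^ c * p ^ a := by rw [← ho, pow_add]
    have eq : q ^ m = q ^ d * q ^ b := by rw [← he, pow_add]
    rw [ep, eq, one_div_pow, one_div_pow]
    field_simp
  rw [key]
  generalize A (2 * (m + 1)) (1 / p) (1 / q) = B
  rw [mul_pow, pow_succ q]
  field_simp
  try ring
end

section
/- For every integer n ≥ 1 and every real number p, Σ_{π ∈ S_n} p^{odes(π)} = (n!/2^{⌊n/2⌋})·(1 + p)^{⌊n/2⌋}; equivalently, for every integer i, the number of permutations π of [n] with odes(π) = i equals (n!/2^{⌊n/2⌋})·C(⌊n/2⌋, i). -/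
theorem odes_eq (n : ℕ) (π : Equiv.Perm (Fin n)) :
    odes n π = ((Finset.range (n / 2)).filter fun k => IsDesc π (2 * k + 1)).card := by
  unfold odes
  symm
  apply Finset.card_bij (fun k _ => 2 * k + 1)
  · intro k hk
    simp only [Finset.mem_filter, Finset.mem_range] at hk ⊢
    exact ⟨by omega, ⟨k, rfl⟩, hk.2⟩
  · intro a _ b _ h
    omega
  · intro b hb
    simp only [Finset.mem_filter, Finset.mem_range] at hb
    obtain ⟨h1, ⟨k, rfl⟩, h3⟩ := hb
    exact ⟨k, by simp only [Finset.mem_filter, Finset.mem_range]; exact ⟨by omega, h3⟩, rfl⟩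

theorem isDesc_iff_s7 {n : ℕ} (π : Equiv.Perm (Fin n)) (k : ℕ) (h : 2 * k + 1 < n) :
    IsDesc π (2 * k + 1) ↔ π ⟨2 * k + 1, h⟩ < π ⟨2 * k, by omega⟩ := by
  unfold IsDesc
  constructor
  · rintro ⟨_, _, h3⟩
    exact h3
  · intro h3
    exact ⟨h, by omega, h3⟩

theorem partial_sum {R : Type*} [CommSemiring R] (n : ℕ) (p : R) (k : ℕ) (hk : k ≤ n / 2) :
    2 ^ k * (∑ π : Equiv.Perm (Fin n),
      ∏ j ∈ Finset.range k, if IsDesc π (2 * j + 1) then p else 1) =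
      (n.factorial : R) * (1 + p) ^ k := by
  induction k with
  | zero => simp [Fintype.card_perm]
  | succ k ih =>
    have ih := ih (by omega)
    have hb : 2 * k + 1 < n := by omega
    have ha : 2 * k < n := by omega
    let s : Equiv.Perm (Fin n) := Equiv.swap ⟨2 * k, ha⟩ ⟨2 * k + 1, hb⟩
    have hs : (∑ π : Equiv.Perm (Fin n),
        ∏ j ∈ Finset.range (k + 1), if IsDesc (π * s) (2 * j + 1) then p else 1) =
        ∑ π : Equiv.Perm (Fin n),
          ∏ j ∈ Finset.range (k + 1), if IsDesc π (2 * j + 1) then p else 1 :=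
      Equiv.sum_comp (Equiv.mulRight s) (fun π : Equiv.Perm (Fin n) =>
      ∏ j ∈ Finset.range (k + 1), if IsDesc π (2 * j + 1) then p else 1)
    have key : ∀ π : Equiv.Perm (Fin n),
        (∏ j ∈ Finset.range (k + 1), if IsDesc π (2 * j + 1) then p else 1) +
        (∏ j ∈ Finset.range (k + 1), if IsDesc (π * s) (2 * j + 1) then p else 1) =
        (∏ j ∈ Finset.range k, if IsDesc π (2 * j + 1) then p else 1) * (1 + p) := by
      intro π
      rw [Finset.prod_range_succ, Finset.prod_range_succ]
      have h1 : (∏ j ∈ Finset.range k, if IsDesc (π * s) (2 * j + 1) then p else 1) =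
          ∏ j ∈ Finset.range k, if IsDesc π (2 * j + 1) then p else 1 := by
        apply Finset.prod_congr rfl
        intro j hj
        rw [Finset.mem_range] at hj
        have hj' : 2 * j + 1 < n := by omega
        have e1 : s ⟨2 * j + 1, hj'⟩ = ⟨2 * j + 1, hj'⟩ :=
          Equiv.swap_apply_of_ne_of_ne (by simp; omega) (by simp; omega)
        have e2 : s ⟨2 * j, by omega⟩ = ⟨2 * j, by omega⟩ :=
          Equiv.swap_apply_of_ne_of_ne (by simp; omega) (by simp; omega)
        simp only [isDesc_iff_s7 _ j hj', Equiv.Perm.mul_apply, e1, e2]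
      have e1 : s ⟨2 * k + 1, hb⟩ = ⟨2 * k, ha⟩ := Equiv.swap_apply_right _ _
      have e2 : s ⟨2 * k, ha⟩ = ⟨2 * k + 1, hb⟩ := Equiv.swap_apply_left _ _
      rw [h1, ← mul_add]
      congr 1
      simp only [isDesc_iff_s7 _ k hb, Equiv.Perm.mul_apply, e1, e2]
      have hne : π ⟨2 * k, ha⟩ ≠ π ⟨2 * k + 1, hb⟩ := by
        intro h
        have := π.injective h
        simp at this
      rcases lt_or_gt_of_ne hne with h | h
      · rw [if_neg (not_lt.mpr h.le), if_pos h]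
      · rw [if_pos h, if_neg (not_lt.mpr h.le), add_comm]
    have h2 := Finset.sum_congr (rfl : (Finset.univ : Finset (Equiv.Perm (Fin n))) = _)
      (fun π _ => key π)
    rw [Finset.sum_add_distrib, ← Finset.sum_mul] at h2
    rw [hs] at h2
    rw [pow_succ, mul_assoc, two_mul, h2, ← mul_assoc, ih, mul_assoc, ← pow_succ]

theorem full_sum {R : Type*} [CommSemiring R] (n : ℕ) (p : R) :
    2 ^ (n / 2) * (∑ π : Equiv.Perm (Fin n), p ^ odes n π) =
      (n.factorial : R) * (1 + p) ^ (n / 2) := by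
  rw [← partial_sum n p (n / 2) le_rfl]
  congr 1
  apply Finset.sum_congr rfl
  intro π _
  rw [odes_eq, Finset.prod_ite]
  simp

theorem count_eq (n i : ℕ) :
    2 ^ (n / 2) * (Finset.univ.filter fun π : Equiv.Perm (Fin n) => odes n π = i).card =
      n.factorial * (n / 2).choose i := by
  have h := congrArg (fun q => Polynomial.coeff q i)
    (full_sum n (Polynomial.X : Polynomial ℕ))
  have e : (2 : Polynomial ℕ) ^ (n / 2) = Polynomial.C (2 ^ (n / 2)) := by simp
  have e' : (n.factorial : Polynomial ℕ) = Polynomial.C n.factorial := by simp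
  simp only [e, e', Polynomial.coeff_C_mul, Polynomial.finsetSum_coeff, Polynomial.coeff_X_pow,
    Polynomial.coeff_one_add_X_pow] at h
  rw [Finset.card_filter]
  simpa [eq_comm] using h

theorem stmt7 (n : ℕ) (hn : 1 ≤ n) (p : ℝ) (i : ℕ) :
    (∑ π : Equiv.Perm (Fin n), p ^ odes n π) =
      ((n.factorial : ℝ) / 2 ^ (n / 2)) * (1 + p) ^ (n / 2) ∧
    (Finset.univ.filter fun π : Equiv.Perm (Fin n) => odes n π = i).card =
      (n.factorial / 2 ^ (n / 2)) * (n / 2).choose i := by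
  constructor
  · have h := full_sum n p
    rw [div_mul_eq_mul_div, ← h]
    field_simp
  · have h := count_eq n i
    have h0 := count_eq n 0
    rw [Nat.choose_zero_right, mul_one] at h0
    have hpos : 0 < 2 ^ (n / 2) := by positivity
    rw [← h0, Nat.mul_div_cancel_left _ hpos]
    rw [← h0, mul_assoc] at h
    exact Nat.eq_of_mul_eq_mul_left hpos h
end

section
/- For every integer n ≥ 1 and every real number q, Σ_{π ∈ S_n} q^{edes(π)} = (n!/2^{⌊(n−1)/2⌋})·(1 + q)^{⌊(n−1)/2⌋}; equivalently, for every integer j, the number of permutations π of [n] with edes(π) = j equals (n!/2^{⌊(n−1)/2⌋})·C(⌊(n−1)/2⌋, j). -/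
/-- the number of descents at the even positions `2, 4, …, 2k` -/
def ecount {n : ℕ} (π : Equiv.Perm (Fin n)) (k : ℕ) : ℕ :=
  ∑ i ∈ Finset.range k, if IsDesc π (2 * (i + 1)) then 1 else 0

theorem edes_eq_ecount (n : ℕ) (π : Equiv.Perm (Fin n)) :
    edes n π = ecount π ((n - 1) / 2) := by
  unfold edes ecount
  rw [← Finset.card_filter]
  symm
  refine Finset.card_bij (fun i _ => 2 * (i + 1)) ?_ ?_ ?_
  · intro i hi
    simp only [Finset.mem_filter, Finset.mem_range] at hi ⊢
    exact ⟨by omega, ⟨i + 1, by ring⟩, hi.2⟩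
  · intro a _ b _ h
    omega
  · intro b hb
    simp only [Finset.mem_filter, Finset.mem_range] at hb
    obtain ⟨hb1, ⟨c, hc⟩, hd⟩ := hb
    have hpos : 0 < b := hd.2.1
    have hbc : 2 * (c - 1 + 1) = b := by omega
    refine ⟨c - 1, ?_, hbc⟩
    simp only [Finset.mem_filter, Finset.mem_range]
    rw [hbc]
    exact ⟨by omega, hd⟩

theorem main_identity {R : Type*} [CommSemiring R] (n : ℕ) (q : R) (k : ℕ)
    (hk : 2 * k < n ∨ k = 0) :
    2 ^ k * ∑ π : Equiv.Perm (Fin n), q ^ ecount π k = (n.factorial : R) * (1 + q) ^ k := by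
  induction k with
  | zero => simp [ecount, Fintype.card_perm]
  | succ k ih =>
    have hkn : 2 * (k + 1) < n := by omega
    have ih' := ih (by omega)
    let s : Equiv.Perm (Fin n) := Equiv.swap ⟨2 * k + 1, by omega⟩ ⟨2 * (k + 1), hkn⟩
    have h1 : ∀ π : Equiv.Perm (Fin n), ecount (π * s) k = ecount π k := by
      intro π
      unfold ecount
      refine Finset.sum_congr rfl fun i hi => ?_
      rw [Finset.mem_range] at hi
      have e1 : ∀ h : 2 * (i + 1) < n, s ⟨2 * (i + 1), h⟩ = ⟨2 * (i + 1), h⟩ := fun h =>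
        Equiv.swap_apply_of_ne_of_ne (by simp [Fin.ext_iff]; omega) (by simp [Fin.ext_iff]; omega)
      have e2 : ∀ h : 2 * (i + 1) - 1 < n, s ⟨2 * (i + 1) - 1, h⟩ = ⟨2 * (i + 1) - 1, h⟩ :=
        fun h =>
        Equiv.swap_apply_of_ne_of_ne (by simp [Fin.ext_iff]; omega) (by simp [Fin.ext_iff]; omega)
      have : IsDesc (π * s) (2 * (i + 1)) ↔ IsDesc π (2 * (i + 1)) := by
        unfold IsDesc
        simp only [Equiv.Perm.mul_apply, e1, e2]
      simp only [this]
    have h2 : ∀ π : Equiv.Perm (Fin n),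
        IsDesc (π * s) (2 * (k + 1)) ↔ ¬ IsDesc π (2 * (k + 1)) := by
      intro π
      have f1 : s ⟨2 * (k + 1), hkn⟩ = ⟨2 * k + 1, by omega⟩ := Equiv.swap_apply_right _ _
      have f2 : s ⟨2 * k + 1, by omega⟩ = ⟨2 * (k + 1), hkn⟩ := Equiv.swap_apply_left _ _
      have key : ∀ σ : Equiv.Perm (Fin n), IsDesc σ (2 * (k + 1)) ↔
          σ ⟨2 * (k + 1), hkn⟩ < σ ⟨2 * k + 1, by omega⟩ := fun σ =>
        ⟨fun h => h.2.2, fun h => ⟨hkn, by omega, h⟩⟩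
      rw [key, key, Equiv.Perm.mul_apply, Equiv.Perm.mul_apply, f1, f2]
      have hne : π ⟨2 * k + 1, by omega⟩ ≠ π ⟨2 * (k + 1), hkn⟩ := by
        intro h
        have := π.injective h
        simp only [Fin.mk.injEq] at this
        omega
      exact ⟨fun h => not_lt.mpr h.le, fun h => lt_of_le_of_ne (not_lt.mp h) hne⟩
    have h3 : ∀ π : Equiv.Perm (Fin n), q ^ ecount π (k + 1) =
        q ^ ecount π k * (if IsDesc π (2 * (k + 1)) then q else 1) := by
      intro π
      unfold ecount
      rw [Finset.sum_range_succ, pow_add]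
      split_ifs <;> simp
    have h4 : ∑ π : Equiv.Perm (Fin n), q ^ ecount π (k + 1) =
        ∑ π : Equiv.Perm (Fin n), q ^ ecount (π * s) (k + 1) :=
      (Equiv.sum_comp (Equiv.mulRight s) (fun π => q ^ ecount π (k + 1))).symm
    have h5 : 2 * ∑ π : Equiv.Perm (Fin n), q ^ ecount π (k + 1) =
        (∑ π : Equiv.Perm (Fin n), q ^ ecount π k) * (1 + q) := by
      rw [two_mul]
      nth_rewrite 2 [h4]
      rw [← Finset.sum_add_distrib, Finset.sum_mul]
      refine Finset.sum_congr rfl fun π _ => ?_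
      rw [h3, h3, h1]
      simp only [h2]
      by_cases h : IsDesc π (2 * (k + 1)) <;> simp [h] <;> ring
    rw [pow_succ, mul_assoc, h5, ← mul_assoc, ih', pow_succ, mul_assoc]

theorem stmt8 (n : ℕ) (hn : 1 ≤ n) (q : ℝ) (j : ℕ) :
    (∑ π : Equiv.Perm (Fin n), q ^ edes n π) =
      ((n.factorial : ℝ) / 2 ^ ((n - 1) / 2)) * (1 + q) ^ ((n - 1) / 2) ∧
    (Finset.univ.filter fun π : Equiv.Perm (Fin n) => edes n π = j).card =
      (n.factorial / 2 ^ ((n - 1) / 2)) * ((n - 1) / 2).choose j := by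
  have hm : 2 * ((n - 1) / 2) < n ∨ (n - 1) / 2 = 0 := by omega
  constructor
  · have h := main_identity n q _ hm
    simp only [edes_eq_ecount]
    field_simp
    linarith
  · have h := main_identity n (Polynomial.X : Polynomial ℕ) _ hm
    have hc : ∀ j : ℕ, 2 ^ ((n - 1) / 2) *
        (Finset.univ.filter fun π : Equiv.Perm (Fin n) => edes n π = j).card =
        n.factorial * ((n - 1) / 2).choose j := by
      intro j
      have h' := congrArg (fun p => Polynomial.coeff p j) h
      have e2 : (2 : Polynomial ℕ) ^ ((n - 1) / 2) =
          Polynomial.C (2 ^ ((n - 1) / 2)) := by simp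
      have e3 : (n.factorial : Polynomial ℕ) = Polynomial.C n.factorial := by simp
      simp only [e2, e3, Polynomial.coeff_C_mul, Polynomial.finsetSum_coeff,
        Polynomial.coeff_X_pow, Polynomial.coeff_one_add_X_pow] at h'
      rw [Finset.card_filter]
      simp only [edes_eq_ecount, eq_comm (b := j)]
      simpa using h'
    have h0 := hc 0
    rw [Nat.choose_zero_right, mul_one] at h0
    have hpos : 0 < 2 ^ ((n - 1) / 2) := by positivity
    rw [← h0, Nat.mul_div_cancel_left _ hpos]
    have hj := hc j
    rw [← h0, mul_assoc] at hj
    exact Nat.eq_of_mul_eq_mul_left hpos hj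
end

section
/- For every integer k ≥ 1 and all real numbers p and q, Σ_{π ∈ S_{2k}} p^{odes(π)} (q^{edes(π)} + q^{edes(π)+1}) = Σ_{π ∈ S_{2k}} q^{odes(π)} (p^{edes(π)} + p^{edes(π)+1}). -/
open Finset in
/-- product weight of the descents of a permutation -/
noncomputable def wtP (w : ℕ → ℝ) (n : ℕ) (π : Equiv.Perm (Fin (n + 1))) : ℝ :=
  ∏ i : Fin n, if π i.succ < π i.castSucc then w i else 1

/-- insert a new first entry `i` -/
def insP {n : ℕ} (x : Fin (n + 1) × Equiv.Perm (Fin n)) : Equiv.Perm (Fin (n + 1)) :=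
  ((finSuccEquiv n).trans (Equiv.optionCongr x.2)).trans (finSuccEquiv' x.1).symm

theorem insP_zero {n : ℕ} (x : Fin (n + 1) × Equiv.Perm (Fin n)) : insP x 0 = x.1 := by
  simp [insP]

theorem insP_succ {n : ℕ} (x : Fin (n + 1) × Equiv.Perm (Fin n)) (j : Fin n) :
    insP x j.succ = x.1.succAbove (x.2 j) := by
  simp [insP]

theorem insP_bij (n : ℕ) : Function.Bijective (insP (n := n)) := by
  rw [Fintype.bijective_iff_injective_and_card]
  constructor
  · rintro ⟨i, σ⟩ ⟨j, τ⟩ h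
    have h0 : i = j := by
      have := insP_zero (i, σ)
      rw [h, insP_zero] at this
      exact this.symm
    subst h0
    congr 1
    ext1 k
    have h1 := insP_succ (i, σ) k
    rw [h, insP_succ] at h1
    exact (Fin.succAbove_right_injective h1).symm
  · simp [Fintype.card_perm, Nat.factorial_succ]

/-- shifted weights -/
def shW (w : ℕ → ℝ) (c : ℕ) : ℕ → ℝ := fun j => w (j + c)

theorem wtP_insP (w : ℕ → ℝ) (n : ℕ) (i : Fin (n + 2)) (σ : Equiv.Perm (Fin (n + 1))) :
    wtP w (n + 1) (insP (i, σ)) =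
      (if (σ 0).castSucc < i then w 0 else 1) * wtP (shW w 1) n σ := by
  unfold wtP
  rw [Fin.prod_univ_succ]
  congr 1
  · rw [insP_succ, Fin.castSucc_zero, insP_zero]
    simp [Fin.succAbove_lt_iff_castSucc_lt]
  · refine Finset.prod_congr rfl fun j _ => ?_
    rw [insP_succ, ← Fin.succ_castSucc, insP_succ]
    simp [shW]

/-- weights by first entry -/
noncomputable def GG : ℕ → (ℕ → ℝ) → ℕ → ℝ
  | 0, _, _ => 1
  | n + 1, w, i => ∑ j ∈ Finset.range (n + 1), GG n (shW w 1) j +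
      (w 0 - 1) * ∑ j ∈ Finset.range i, GG n (shW w 1) j

theorem sum_split (n i : ℕ) (hi : i ≤ n) (a : ℝ) (f : ℕ → ℝ) :
    ∑ j : Fin n, (if (j : ℕ) < i then a else 1) * f j =
      ∑ j ∈ Finset.range n, f j + (a - 1) * ∑ j ∈ Finset.range i, f j := by
  rw [Fin.sum_univ_eq_sum_range (fun j => (if j < i then a else 1) * f j) n]
  obtain ⟨m, rfl⟩ := Nat.exists_eq_add_of_le hi
  rw [Finset.sum_range_add, Finset.sum_range_add]
  have h1 : ∑ j ∈ Finset.range i, (if j < i then a else 1) * f j =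
      a * ∑ j ∈ Finset.range i, f j := by
    rw [Finset.mul_sum]
    refine Finset.sum_congr rfl fun j hj => ?_
    rw [if_pos (Finset.mem_range.1 hj)]
  have h2 : ∑ j ∈ Finset.range m, (if i + j < i then a else 1) * f (i + j) =
      ∑ j ∈ Finset.range m, f (i + j) := by
    refine Finset.sum_congr rfl fun j hj => ?_
    rw [if_neg (by omega), one_mul]
  rw [h1, h2]; ring

theorem sum_wtP (n : ℕ) : ∀ (w : ℕ → ℝ) (f : Fin (n + 1) → ℝ),
    ∑ σ : Equiv.Perm (Fin (n + 1)), f (σ 0) * wtP w n σ = ∑ i, f i * GG n w i := by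
  induction n with
  | zero =>
    intro w f
    have : ∀ σ : Equiv.Perm (Fin (0 + 1)), f (σ 0) * wtP w 0 σ = f 0 := by
      intro σ
      rw [show σ 0 = 0 from Fin.ext (by omega)]
      simp [wtP]
    rw [Finset.sum_congr rfl fun σ _ => this σ]
    simp [GG, Fintype.card_perm]
  | succ n ih =>
    intro w f
    rw [← (insP_bij (n + 1)).sum_comp, Fintype.sum_prod_type]
    refine Finset.sum_congr rfl fun i _ => ?_
    simp only [insP_zero, wtP_insP]
    rw [← Finset.mul_sum, ih (shW w 1) (fun j => if j.castSucc < i then w 0 else 1)]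
    congr 1
    rw [GG, ← sum_split (n + 1) i (by omega)]
    rfl

/-- total weights -/
noncomputable def AA (w : ℕ → ℝ) : ℕ → ℝ
  | 0 => 1
  | n + 1 => ∑ j ∈ Finset.range (n + 1), GG n w j

theorem AA_eq (w : ℕ → ℝ) (n : ℕ) :
    ∑ σ : Equiv.Perm (Fin (n + 1)), wtP w n σ = AA w (n + 1) := by
  have := sum_wtP n w (fun _ => 1)
  simp only [one_mul] at this
  rw [this, AA, Fin.sum_univ_eq_sum_range (fun j => GG n w j)]

theorem hockey (i c : ℕ) :
    ∑ j ∈ Finset.range i, ((j.choose c : ℕ) : ℝ) = ((i.choose (c + 1) : ℕ) : ℝ) := by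
  induction i with
  | zero => simp
  | succ i ih => rw [Finset.sum_range_succ, ih, Nat.choose_succ_succ]; push_cast; ring

theorem shW_shW (w : ℕ → ℝ) (a b : ℕ) : shW (shW w a) b = shW w (b + a) := by
  funext j; simp [shW, add_assoc]

theorem sum_GG (n m : ℕ) (w : ℕ → ℝ)
    (h : ∀ i, GG n w i = ∑ c ∈ Finset.range (n + 1),
      (∏ j ∈ Finset.range c, (w j - 1)) * (i.choose c : ℕ) * AA (shW w (c + 1)) (n - c)) :
    ∑ i ∈ Finset.range m, GG n w i = ∑ c ∈ Finset.range (n + 1),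
      (∏ j ∈ Finset.range c, (w j - 1)) * (m.choose (c + 1) : ℕ) *
        AA (shW w (c + 1)) (n - c) := by
  simp only [h]
  rw [Finset.sum_comm]
  refine Finset.sum_congr rfl fun c _ => ?_
  rw [← hockey, Finset.mul_sum, Finset.sum_mul]

theorem GG_eq (n : ℕ) : ∀ (w : ℕ → ℝ) (i : ℕ),
    GG n w i = ∑ c ∈ Finset.range (n + 1),
      (∏ j ∈ Finset.range c, (w j - 1)) * (i.choose c : ℕ) * AA (shW w (c + 1)) (n - c) := by
  induction n with
  | zero => intro w i; simp [GG, AA]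
  | succ n ih =>
    intro w i
    rw [GG, sum_GG n i _ (ih _), Finset.sum_range_succ' _ (n + 1)]
    refine (add_comm _ _).trans ?_
    congr 1
    · rw [Finset.mul_sum]
      refine Finset.sum_congr rfl fun c _ => ?_
      rw [Finset.prod_range_succ', shW_shW, Nat.add_sub_add_right]
      simp only [shW]
      ring
    · simp [AA]

theorem AA_rec (n : ℕ) (w : ℕ → ℝ) :
    AA w (n + 1) = ∑ c ∈ Finset.range (n + 1),
      (∏ j ∈ Finset.range c, (w j - 1)) * ((n + 1).choose (c + 1) : ℕ) *
        AA (shW w (c + 1)) (n - c) := by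
  rw [AA, sum_GG n _ w (GG_eq n w)]

/-- alternating weights -/
noncomputable def altW (p q : ℝ) : ℕ → ℝ := fun j => if Even j then p else q

theorem altW_even (p q : ℝ) (c : ℕ) (hc : Even c) : shW (altW p q) c = altW p q := by
  funext j; simp [shW, altW, Nat.even_add, hc]

theorem altW_odd (p q : ℝ) (c : ℕ) (hc : ¬ Even c) : shW (altW p q) c = altW q p := by
  funext j; by_cases h : Even j <;> simp [shW, altW, Nat.even_add, hc, h]

theorem prod_even (p q : ℝ) (m : ℕ) :
    ∏ j ∈ Finset.range (2 * m), (altW p q j - 1) = ((p - 1) * (q - 1)) ^ m := by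
  induction m with
  | zero => simp
  | succ m ih =>
    rw [show 2 * (m + 1) = 2 * m + 1 + 1 by ring, Finset.prod_range_succ,
      Finset.prod_range_succ, ih]
    simp [altW, Nat.even_add_one, pow_succ]
    ring

theorem prod_odd (p q : ℝ) (m : ℕ) :
    ∏ j ∈ Finset.range (2 * m + 1), (altW p q j - 1) =
      (p - 1) * ((p - 1) * (q - 1)) ^ m := by
  rw [Finset.prod_range_succ, prod_even]
  simp [altW]
  ring

open PowerSeries in
/-- hyperbolic cosine type series -/
noncomputable def serE (t : ℝ) : ℝ⟦X⟧ :=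
  PowerSeries.mk fun n => if Even n ∧ n ≠ 0 then t ^ (n / 2 - 1) / (n.factorial : ℝ) else 0

open PowerSeries in
/-- hyperbolic sine type series -/
noncomputable def serS (t : ℝ) : ℝ⟦X⟧ :=
  PowerSeries.mk fun n => if Even n then 0 else t ^ (n / 2) / (n.factorial : ℝ)

open PowerSeries in
/-- exponential generating function -/
noncomputable def serA (p q : ℝ) : ℝ⟦X⟧ :=
  PowerSeries.mk fun n => AA (altW p q) n / (n.factorial : ℝ)

theorem fact_aux (n c : ℕ) (h : c ≤ n) (x y : ℝ) :
    x * ((n + 1).choose (c + 1) : ℕ) * y / ((n + 1).factorial : ℝ) =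
      x / ((c + 1).factorial : ℝ) * (y / ((n - c).factorial : ℝ)) := by
  have := Nat.choose_mul_factorial_mul_factorial (Nat.succ_le_succ h)
  simp only [Nat.succ_eq_add_one, Nat.add_sub_add_right] at this
  rw [← this]
  have h1 : ((c + 1).factorial : ℝ) ≠ 0 := by positivity
  have h2 : ((n - c).factorial : ℝ) ≠ 0 := by positivity
  have h3 : (((n + 1).choose (c + 1) : ℕ) : ℝ) ≠ 0 := by
    exact_mod_cast (Nat.choose_pos (Nat.succ_le_succ h)).ne'
  push_cast
  field_simp

open PowerSeries in
theorem serA_rec (p q : ℝ) :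
    serA p q = 1 + C (p - 1) * serE ((p - 1) * (q - 1)) * serA p q +
      serS ((p - 1) * (q - 1)) * serA q p := by
  ext n
  rcases n with _ | n
  · simp [serA, serE, serS, AA]
  · rw [map_add, map_add, coeff_mul, coeff_mul, Finset.Nat.sum_antidiagonal_succ,
      Finset.Nat.sum_antidiagonal_succ, coeff_C_mul]
    have e0 : coeff 0 (serE ((p - 1) * (q - 1))) = 0 := by simp [serE]
    have s0 : coeff 0 (serS ((p - 1) * (q - 1))) = 0 := by simp [serS]
    rw [e0, s0, coeff_one, if_neg (by omega), mul_zero, zero_mul, zero_mul, zero_add, zero_add,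
      zero_add, ← Finset.sum_add_distrib]
    rw [Finset.Nat.sum_antidiagonal_eq_sum_range_succ_mk]
    simp only [serA, coeff_mk]
    rw [AA_rec, Finset.sum_div]
    refine Finset.sum_congr rfl fun c hc => ?_
    have hc' : c ≤ n := by simpa [Nat.lt_succ_iff] using hc
    rw [fact_aux n c hc', coeff_C_mul]
    simp only [serE, serS, coeff_mk]
    rcases Nat.even_or_odd' c with ⟨m, rfl | rfl⟩
    · rw [prod_even, altW_odd _ _ _ (by simp [Nat.even_add_one])]
      rw [if_neg (by simp [Nat.even_add_one]), if_neg (by simp [Nat.even_add_one]),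
        show (2 * m + 1) / 2 = m by omega]
      ring
    · rw [prod_odd, altW_even _ _ _ (by simp [Nat.even_add_one])]
      rw [if_pos (by simp [Nat.even_add_one]), if_pos (by simp [Nat.even_add_one]),
        show (2 * m + 1 + 1) / 2 - 1 = m by omega]
      ring

theorem fact_aux2 (n : ℕ) (x : ℝ) :
    x / ((n + 1).factorial : ℝ) * ((n : ℝ) + 1) = x / (n.factorial : ℝ) := by
  rw [Nat.factorial_succ]
  have h1 : (n.factorial : ℝ) ≠ 0 := by positivity
  have h2 : (n : ℝ) + 1 ≠ 0 := by positivity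
  push_cast
  field_simp

open PowerSeries in
theorem deriv_serE (t : ℝ) : derivative ℝ (serE t) = serS t := by
  ext n
  rw [coeff_derivative]
  simp only [serE, serS, coeff_mk]
  rcases Nat.even_or_odd' n with ⟨m, rfl | rfl⟩
  · simp [Nat.even_add_one]
  · rw [if_pos (by simp [Nat.even_add_one]), if_neg (by simp [Nat.even_add_one]), fact_aux2,
      show (2 * m + 1 + 1) / 2 - 1 = (2 * m + 1) / 2 by omega]

open PowerSeries in
theorem deriv_serS (t : ℝ) : derivative ℝ (serS t) = 1 + C t * serE t := by
  ext n
  rw [coeff_derivative, map_add, coeff_C_mul]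
  simp only [serE, serS, coeff_mk, coeff_one]
  rcases Nat.even_or_odd' n with ⟨m, rfl | rfl⟩
  · rw [if_neg (by simp [Nat.even_add_one]), fact_aux2, show (2 * m + 1) / 2 = m by omega]
    rcases m with _ | m
    · simp
    · rw [if_neg (by omega), if_pos (by simp), show 2 * (m + 1) / 2 - 1 = m by omega]
      ring
  · simp [Nat.even_add_one]

open PowerSeries in
theorem serS_sq (t : ℝ) : serS t ^ 2 = 2 * serE t + C t * serE t ^ 2 := by
  apply derivative.ext
  · have h2 : derivative ℝ (2 : ℝ⟦X⟧) = 0 := by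
      exact derivative_C (R := ℝ) (r := 2)
    simp only [pow_two, map_add, Derivation.leibniz, smul_eq_mul, deriv_serE, deriv_serS,
      derivative_C, h2]
    ring
  · simp [serE, serS]

open PowerSeries in
theorem rescale_serE (t : ℝ) : rescale (-1 : ℝ) (serE t) = serE t := by
  ext n
  rw [coeff_rescale]
  simp only [serE, coeff_mk]
  split_ifs with h
  · rw [h.1.neg_one_pow, one_mul]
  · simp

open PowerSeries in
theorem rescale_serS (t : ℝ) : rescale (-1 : ℝ) (serS t) = - serS t := by
  ext n
  rw [coeff_rescale, map_neg]
  simp only [serS, coeff_mk]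
  split_ifs with h
  · simp
  · rw [(Nat.not_even_iff_odd.1 h).neg_one_pow]; ring

open PowerSeries in
theorem rescale_C' (r : ℝ) : rescale (-1 : ℝ) (C r : ℝ⟦X⟧) = C r := by
  ext n
  rw [coeff_rescale, coeff_C]
  split_ifs with h
  · simp [h]
  · simp

open PowerSeries in
theorem key (p q : ℝ) (k : ℕ) (hk : 1 ≤ k) :
    (1 + q) * AA (altW p q) (2 * k) = (1 + p) * AA (altW q p) (2 * k) := by
  have h1 := serA_rec p q
  have h2 := serA_rec q p
  rw [mul_comm (q - 1) (p - 1)] at h2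
  have h3 := serS_sq ((p - 1) * (q - 1))
  have hE := rescale_serE ((p - 1) * (q - 1))
  have hS := rescale_serS ((p - 1) * (q - 1))
  have hE0 : constantCoeff (serE ((p - 1) * (q - 1))) = 0 := by simp [serE]
  have hS0 : constantCoeff (serS ((p - 1) * (q - 1))) = 0 := by simp [serS]
  have hp := rescale_C' (p - 1)
  have hq := rescale_C' (q - 1)
  have hpq : (C ((p - 1) * (q - 1)) : ℝ⟦X⟧) = C (p - 1) * C (q - 1) := map_mul _ _ _
  rw [hpq] at h3
  generalize serE ((p - 1) * (q - 1)) = E at *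
  generalize serS ((p - 1) * (q - 1)) = S at *
  have hP : (C (1 + p) : ℝ⟦X⟧) = C (p - 1) + 2 := by
    rw [show 1 + p = (p - 1) + 2 by ring, map_add]; rfl
  have hQ : (C (1 + q) : ℝ⟦X⟧) = C (q - 1) + 2 := by
    rw [show 1 + q = (q - 1) + 2 by ring, map_add]; rfl
  set Y : ℝ⟦X⟧ := C (1 + q) * (serA p q - 1) - C (1 + p) * (serA q p - 1) with hY
  rw [hP, hQ] at hY
  generalize (C (p - 1) : ℝ⟦X⟧) = P at *
  generalize (C (q - 1) : ℝ⟦X⟧) = Q at *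
  set D : ℝ⟦X⟧ := (1 - P * E) * (1 - Q * E) - S ^ 2 with hD
  have hA : D * (serA p q - 1) = E * (P + 2) + S := by
    rw [hD]
    linear_combination (1 - Q * E) * h1 + S * h2 + h3
  have hB : D * (serA q p - 1) = E * (Q + 2) + S := by
    rw [hD]
    linear_combination (1 - P * E) * h2 + S * h1 + h3
  have hDY : D * Y = S * (Q - P) := by
    rw [hY]
    linear_combination (Q + 2) * hA - (P + 2) * hB
  have hDr : rescale (-1 : ℝ) D = D := by
    rw [hD]; simp only [map_sub, map_mul, map_one, map_pow, hE, hS, hp, hq]; ring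
  have hDY' : D * rescale (-1 : ℝ) Y = - (S * (Q - P)) := by
    have := congrArg (rescale (-1 : ℝ)) hDY
    simp only [map_mul, map_sub, hDr, hS, hp, hq] at this
    rw [this]; ring
  have hD0 : D ≠ 0 := by
    intro h
    have := congrArg constantCoeff h
    rw [hD] at this
    simp [hE0, hS0] at this
  have hsum : D * (Y + rescale (-1 : ℝ) Y) = 0 := by rw [mul_add, hDY, hDY']; ring
  have h0 := (mul_eq_zero.1 hsum).resolve_left hD0
  have hc := congrArg (coeff (2 * k)) h0
  rw [map_add, coeff_rescale, (even_two_mul k).neg_one_pow, one_mul, map_zero] at hc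
  have hc' : coeff (2 * k) Y = 0 := by linarith
  have hY' : Y = C (1 + q) * (serA p q - 1) - C (1 + p) * (serA q p - 1) := by
    rw [hY, hP, hQ]
  rw [hY', map_sub, coeff_C_mul, coeff_C_mul, map_sub, map_sub, coeff_one,
    if_neg (by omega)] at hc'
  simp only [serA, coeff_mk] at hc'
  have hf : ((2 * k).factorial : ℝ) ≠ 0 := by positivity
  field_simp at hc'
  linarith

theorem wtP_eq (p q : ℝ) (n : ℕ) (π : Equiv.Perm (Fin (n + 1))) :
    p ^ odes (n + 1) π * q ^ edes (n + 1) π = wtP (altW p q) n π := by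
  unfold odes edes wtP
  rw [← Finset.prod_const, ← Finset.prod_const, Finset.prod_filter, Finset.prod_filter,
    ← Finset.prod_mul_distrib, Finset.prod_range_succ', ← Fin.prod_univ_eq_prod_range]
  have hz : ¬ IsDesc π 0 := by rintro ⟨_, h, _⟩; omega
  simp only [hz, and_false, if_false, mul_one]
  refine Finset.prod_congr rfl fun i _ => ?_
  have hd : IsDesc π (i + 1) ↔ π i.succ < π i.castSucc := by
    constructor
    · rintro ⟨h, _, h2⟩; exact h2
    · intro h; exact ⟨by omega, by omega, h⟩
  simp only [hd, altW]
  by_cases h : Even (i : ℕ) <;> by_cases h' : π i.succ < π i.castSucc <;>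
    simp [h, h', Nat.even_add_one, Nat.odd_add_one]

theorem stmt18 (k : ℕ) (hk : 1 ≤ k) (p q : ℝ) :
    ∑ π : Equiv.Perm (Fin (2 * k)),
        p ^ odes (2 * k) π * (q ^ edes (2 * k) π + q ^ (edes (2 * k) π + 1)) =
      ∑ π : Equiv.Perm (Fin (2 * k)),
        q ^ odes (2 * k) π * (p ^ edes (2 * k) π + p ^ (edes (2 * k) π + 1)) := by
  have key' := key p q k hk
  obtain ⟨n, hn⟩ : ∃ n, 2 * k = n + 1 := ⟨2 * k - 1, by omega⟩
  rw [hn] at key' ⊢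
  have aux : ∀ a b : ℝ, ∑ π : Equiv.Perm (Fin (n + 1)),
      a ^ odes (n + 1) π * (b ^ edes (n + 1) π + b ^ (edes (n + 1) π + 1)) =
      (1 + b) * AA (altW a b) (n + 1) := by
    intro a b
    rw [← AA_eq, Finset.mul_sum]
    refine Finset.sum_congr rfl fun π _ => ?_
    rw [← wtP_eq]
    ring
  rw [aux, aux, key']
end
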